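/- arXiv:math/9808096 — 2 statements merged into one kernel-verified Lean document; each statement's English description precedes it below -/
import Mathlib

section
/- Let T be a ring, let P be a finitely generated projective T-module, and let V be a T-module. Then the supremum t_P(V) of all P-torsion submodules of V is itself a P-torsion submodule of V; in other words, every T-linear map P → V whose range is contained in t_P(V) is zero, so t_P(V) is the largest P-torsion submodule of V. -/
/-- A submodule `X` of `V` is `P`-torsion if every `T`-linear map `P → V` whose range is
contained in `X` is zero (i.e. `Hom_T(P, X) = 0`). -/
def IsPTorsion (T : Type*) [Ring T] {P V : Type*} [AddCommGroup P] [Module T P]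
    [AddCommGroup V] [Module T V] (X : Submodule T V) : Prop :=
  ∀ f : P →ₗ[T] V, LinearMap.range f ≤ X → f = 0

/-- The `P`-torsion submodule `t_P(V)`: the supremum of all `P`-torsion submodules of `V`. -/
def pTorsion (T : Type*) [Ring T] (P V : Type*) [AddCommGroup P] [Module T P]
    [AddCommGroup V] [Module T V] : Submodule T V :=
  sSup {X : Submodule T V | IsPTorsion T (P := P) X}

/-- A supremum of `P`-torsion submodules is `P`-torsion when `P` is projective: a map into the
supremum lifts to the direct sum, where all of its components vanish. -/
theorem IsPTorsion.iSup {T P V ι : Type*} [Ring T] [AddCommGroup P] [Module T P]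
    [AddCommGroup V] [Module T V] [Module.Projective T P] {X : ι → Submodule T V}
    (hX : ∀ i, IsPTorsion T (P := P) (X i)) : IsPTorsion T (P := P) (⨆ i, X i) := by
  classical
  intro f hf
  set s : (Π₀ i, X i) →ₗ[T] V := DFinsupp.lsum ℕ fun i => (X i).subtype with hs
  rw [Submodule.iSup_eq_range_dfinsupp_lsum, ← hs] at hf
  obtain ⟨g, hg⟩ := Module.projective_lifting_property s.rangeRestrict
    (f.codRestrict (LinearMap.range s) fun x => hf ⟨x, rfl⟩) s.surjective_rangeRestrict
  have hg_zero : g = 0 := by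
    ext1 x
    refine DFinsupp.ext fun i => Subtype.ext ?_
    refine LinearMap.congr_fun (hX i ((X i).subtype ∘ₗ DFinsupp.lapply i ∘ₗ g) ?_) x
    rintro _ ⟨y, rfl⟩
    exact (g y i).2
  ext x
  have hx := congrArg Subtype.val (LinearMap.congr_fun hg x)
  simpa [hg_zero] using hx.symm

/-- Let `T` be a ring, `P` a finitely generated projective `T`-module and
`V` a `T`-module.  Then the supremum `t_P(V)` of all `P`-torsion submodules of `V` is itself a
`P`-torsion submodule of `V`: every `T`-linear map `P → V` whose range is contained in
`t_P(V)` is zero.  Hence `t_P(V)` is the largest `P`-torsion submodule of `V`. -/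
theorem statement1 (T : Type*) [Ring T] (P V : Type*) [AddCommGroup P] [Module T P]
    [AddCommGroup V] [Module T V] [Module.Projective T P] [Module.Finite T P] :
    IsPTorsion T (P := P) (pTorsion T P V) ∧
    (∀ X : Submodule T V, IsPTorsion T (P := P) X → X ≤ pTorsion T P V) := by
  refine ⟨?_, fun X hX => le_sSup hX⟩
  rw [pTorsion, sSup_eq_iSup']
  exact IsPTorsion.iSup fun X => X.2
end

section
/- Let A be a semisimple ring, let V be an A-module and let N be an A-submodule of V. Then N is invariant under every A-endomorphism of V (that is, φ(N) ⊆ N for all φ ∈ End_A(V)) if and only if Hom_A(N, V/N) = 0. -/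
/-- Let `A` be a semisimple ring, `V` an `A`-module and `N` an `A`-submodule
of `V`.  Then `N` is invariant under every `A`-endomorphism of `V` if and only if
`Hom_A(N, V/N) = 0`. -/
theorem statement3 {A : Type*} [Ring A] [IsSemisimpleRing A] (V : Type*) [AddCommGroup V]
    [Module A V] (N : Submodule A V) :
    (∀ φ : Module.End A V, Submodule.map φ N ≤ N) ↔
    (∀ f : N →ₗ[A] V ⧸ N, f = 0) := by
  refine ⟨fun h f => ?_, fun h φ => ?_⟩
  · obtain ⟨g, hg⟩ := IsSemisimpleModule.extension_property N.subtype N.injective_subtype f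
    obtain ⟨φ, hφ⟩ := IsSemisimpleModule.lifting_property N.mkQ N.mkQ_surjective g
    ext x
    have hx : φ x ∈ N := h φ (Submodule.mem_map_of_mem x.2)
    rw [← hg, ← hφ]
    simpa using hx
  · rintro _ ⟨x, hx, rfl⟩
    have hf := LinearMap.congr_fun (h (N.mkQ ∘ₗ φ ∘ₗ N.subtype)) ⟨x, hx⟩
    simpa using hf
end
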